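/- Let x, q be complex numbers with |q| < 1. Then Σ_{k,j≥0} (−1)^k · x^k · q^(C(k+j,2)+C(j,2)+j) / ((q;q)_k · (q;q)_j · (q;q)_{k+j}) = (x;q)_∞ / (q;q)_∞, where C(m,2) = m(m−1)/2. -/

import Mathlib

/-- Finite q-Pochhammer symbol `(a; q)_n = ∏_{k=0}^{n-1} (1 - a q^k)`. -/
noncomputable def qPoch (a q : ℂ) (n : ℕ) : ℂ := ∏ k ∈ Finset.range n, (1 - a * q ^ k)

/-- Infinite q-Pochhammer symbol `(a; q)_∞ = ∏_{k=0}^{∞} (1 - a q^k)`. -/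
noncomputable def qPochInf (a q : ℂ) : ℂ := ∏' k : ℕ, (1 - a * q ^ k)

open Filter Topology

theorem qPoch_self_succ (q : ℂ) (n : ℕ) :
    qPoch q q (n + 1) = qPoch q q n * (1 - q ^ (n + 1)) := by
  rw [qPoch, Finset.prod_range_succ, ← qPoch, pow_succ']

theorem one_sub_pow_succ_ne_zero {q : ℂ} (hq : ‖q‖ < 1) (n : ℕ) : 1 - q ^ (n + 1) ≠ 0 := by
  intro h
  have h1 : ‖q ^ (n + 1)‖ < 1 := by
    rw [norm_pow]
    exact pow_lt_one₀ (norm_nonneg _) hq n.succ_ne_zero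
  rw [← sub_eq_zero.mp h] at h1
  simp at h1

theorem qPoch_self_ne_zero {q : ℂ} (hq : ‖q‖ < 1) (n : ℕ) : qPoch q q n ≠ 0 := by
  induction n with
  | zero => simp [qPoch]
  | succ n ih =>
    rw [qPoch_self_succ]
    exact mul_ne_zero ih (one_sub_pow_succ_ne_zero hq n)

theorem summable_norm_neg_mul_pow {q : ℂ} (a : ℂ) (hq : ‖q‖ < 1) :
    Summable fun k : ℕ ↦ ‖-(a * q ^ k)‖ := by
  simpa [norm_mul, norm_pow] using
    (summable_geometric_of_lt_one (norm_nonneg _) hq).mul_left ‖a‖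

theorem tendsto_qPoch {q : ℂ} (a : ℂ) (hq : ‖q‖ < 1) :
    Tendsto (qPoch a q) atTop (𝓝 (qPochInf a q)) := by
  have h := multipliable_one_add_of_summable (summable_norm_neg_mul_pow a hq)
  simp only [← sub_eq_add_neg] at h
  exact h.tendsto_prod_tprod_nat

theorem qPochInf_self_ne_zero {q : ℂ} (hq : ‖q‖ < 1) : qPochInf q q ≠ 0 := by
  have h := tprod_one_add_ne_zero_of_summable (f := fun k ↦ -(q * q ^ k))
    (fun k ↦ by
      rw [← sub_eq_add_neg, ← pow_succ']
      exact one_sub_pow_succ_ne_zero hq k)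
    (summable_norm_neg_mul_pow q hq)
  simpa only [qPochInf, ← sub_eq_add_neg] using h

theorem tendsto_inv_qPoch_self {q : ℂ} (hq : ‖q‖ < 1) :
    Tendsto (fun n ↦ (qPoch q q n)⁻¹) atTop (𝓝 (qPochInf q q)⁻¹) :=
  (tendsto_qPoch q hq).inv₀ (qPochInf_self_ne_zero hq)

theorem exists_norm_inv_qPoch_self_le {q : ℂ} (hq : ‖q‖ < 1) :
    ∃ M : ℝ, 0 ≤ M ∧ ∀ n, ‖(qPoch q q n)⁻¹‖ ≤ M := by
  obtain ⟨M, hM⟩ :=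
    (Metric.isBounded_range_of_tendsto _ (tendsto_inv_qPoch_self hq)).exists_norm_le
  have hM' : ∀ n, ‖(qPoch q q n)⁻¹‖ ≤ M := fun n ↦ hM _ ⟨n, rfl⟩
  exact ⟨M, (norm_nonneg _).trans (hM' 0), hM'⟩

theorem summable_pow_mul_pow_choose_two (r : ℝ) {s : ℝ} (hs0 : 0 ≤ s) (hs : s < 1) :
    Summable fun k : ℕ ↦ r ^ k * s ^ k.choose 2 := by
  refine summable_of_ratio_norm_eventually_le (r := 1 / 2) (by norm_num) ?_
  have h : Tendsto (fun k : ℕ ↦ |r| * s ^ k) atTop (𝓝 0) := by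
    simpa using (tendsto_pow_atTop_nhds_zero_of_lt_one hs0 hs).const_mul |r|
  filter_upwards [h.eventually_le_const (show (0 : ℝ) < 1 / 2 by norm_num)] with k hk
  have h2 : r ^ (k + 1) * s ^ (k + 1).choose 2 = (r * s ^ k) * (r ^ k * s ^ k.choose 2) := by
    rw [Nat.choose_succ_succ' k 1, Nat.choose_one_right]
    ring
  rw [h2, norm_mul]
  refine mul_le_mul_of_nonneg_right ?_ (norm_nonneg _)
  simpa [abs_of_nonneg hs0] using hk

/-- The `k`-th term of Euler's expansion of `(x; q)_∞`. -/
noncomputable def eulerTerm (q x : ℂ) (k : ℕ) : ℂ :=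
  (-1) ^ k * q ^ k.choose 2 * (qPoch q q k)⁻¹ * x ^ k

/-- The `j`-th term of Cauchy's expansion of `1 / (q; q)_∞` with parameter `k`. -/
noncomputable def cauchyTerm (q : ℂ) (k j : ℕ) : ℂ :=
  q ^ j ^ 2 * (q ^ k) ^ j * (qPoch q q j)⁻¹ * (qPoch q q (j + k))⁻¹

theorem norm_eulerTerm_le {q x : ℂ} {M r : ℝ} (hM : ∀ n, ‖(qPoch q q n)⁻¹‖ ≤ M)
    (hx : ‖x‖ ≤ r) (k : ℕ) :
    ‖eulerTerm q x k‖ ≤ M * (r ^ k * ‖q‖ ^ k.choose 2) := by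
  have h1 : ‖x‖ ^ k ≤ r ^ k := pow_le_pow_left₀ (norm_nonneg _) hx k
  calc ‖eulerTerm q x k‖ = ‖(qPoch q q k)⁻¹‖ * (‖x‖ ^ k * ‖q‖ ^ k.choose 2) := by
        simp only [eulerTerm, norm_mul, norm_pow, norm_neg, norm_one, one_pow]
        ring
    _ ≤ M * (r ^ k * ‖q‖ ^ k.choose 2) := by
        refine mul_le_mul (hM k) (by gcongr) (by positivity) ((norm_nonneg _).trans (hM k))

theorem norm_cauchyTerm_le {q : ℂ} (hq : ‖q‖ < 1) {M : ℝ}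
    (hM : ∀ n, ‖(qPoch q q n)⁻¹‖ ≤ M) (k j : ℕ) :
    ‖cauchyTerm q k j‖ ≤ M * M * ‖q‖ ^ j := by
  have hM0 : 0 ≤ M := (norm_nonneg _).trans (hM 0)
  have h1 : ‖q‖ ^ j ^ 2 ≤ ‖q‖ ^ j :=
    pow_le_pow_of_le_one (norm_nonneg _) hq.le (Nat.le_self_pow two_ne_zero j)
  have h2 : (‖q‖ ^ k) ^ j ≤ 1 :=
    pow_le_one₀ (by positivity) (pow_le_one₀ (norm_nonneg _) hq.le)
  calc ‖cauchyTerm q k j‖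
      = ‖q‖ ^ j ^ 2 * (‖q‖ ^ k) ^ j * ‖(qPoch q q j)⁻¹‖ * ‖(qPoch q q (j + k))⁻¹‖ := by
        simp only [cauchyTerm, norm_mul, norm_pow]
    _ ≤ ‖q‖ ^ j * 1 * M * M := by
        gcongr
        exacts [hM _, hM _]
    _ = M * M * ‖q‖ ^ j := by ring

theorem summable_eulerTerm {q : ℂ} (hq : ‖q‖ < 1) (x : ℂ) : Summable (eulerTerm q x) := by
  obtain ⟨M, -, hM⟩ := exists_norm_inv_qPoch_self_le hq
  exact .of_norm_bounded
    ((summable_pow_mul_pow_choose_two ‖x‖ (norm_nonneg q) hq).mul_left M)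
    (norm_eulerTerm_le hM le_rfl)

theorem summable_cauchyTerm {q : ℂ} (hq : ‖q‖ < 1) (k : ℕ) : Summable (cauchyTerm q k) := by
  obtain ⟨M, -, hM⟩ := exists_norm_inv_qPoch_self_le hq
  exact .of_norm_bounded
    ((summable_geometric_of_lt_one (norm_nonneg q) hq).mul_left (M * M))
    (norm_cauchyTerm_le hq hM k)

theorem tsum_eulerTerm_eq_mul {q : ℂ} (hq : ‖q‖ < 1) (x : ℂ) :
    ∑' k, eulerTerm q x k = (1 - x) * ∑' k, eulerTerm q (x * q) k := by
  have hs := summable_eulerTerm hq x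
  have hs' := summable_eulerTerm hq (x * q)
  have h0 : eulerTerm q x 0 - eulerTerm q (x * q) 0 = 0 := by simp [eulerTerm]
  have h1 (k : ℕ) : eulerTerm q x (k + 1) - eulerTerm q (x * q) (k + 1)
      = -x * eulerTerm q (x * q) k := by
    have hP := qPoch_self_ne_zero hq k
    have hf := one_sub_pow_succ_ne_zero hq k
    simp only [eulerTerm, qPoch_self_succ, Nat.choose_succ_succ' k 1, Nat.choose_one_right]
    field_simp
    ring
  have h := (hs.sub hs').tsum_eq_zero_add
  rw [hs.tsum_sub hs', h0, zero_add] at h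
  simp only [h1, tsum_mul_left] at h
  linear_combination h

theorem tsum_eulerTerm_eq_qPoch_mul {q : ℂ} (hq : ‖q‖ < 1) (x : ℂ) (n : ℕ) :
    ∑' k, eulerTerm q x k = qPoch x q n * ∑' k, eulerTerm q (x * q ^ n) k := by
  induction n with
  | zero => simp [qPoch]
  | succ n ih =>
    rw [ih, tsum_eulerTerm_eq_mul hq, qPoch, qPoch, Finset.prod_range_succ, pow_succ]
    ring_nf

/-- Euler's expansion of the infinite q-Pochhammer symbol. -/
theorem tsum_eulerTerm {q : ℂ} (hq : ‖q‖ < 1) (x : ℂ) :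
    ∑' k, eulerTerm q x k = qPochInf x q := by
  obtain ⟨M, -, hM⟩ := exists_norm_inv_qPoch_self_le hq
  have hx : Tendsto (fun n : ℕ ↦ x * q ^ n) atTop (𝓝 0) := by
    simpa using (tendsto_pow_atTop_nhds_zero_of_norm_lt_one hq).const_mul x
  have hlim : Tendsto (fun n : ℕ ↦ ∑' k, eulerTerm q (x * q ^ n) k) atTop
      (𝓝 (∑' k, eulerTerm q 0 k)) := by
    refine tendsto_tsum_of_dominated_convergence
      ((summable_pow_mul_pow_choose_two ‖x‖ (norm_nonneg q) hq).mul_left M)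
      (fun k ↦ (hx.pow k).const_mul _) (.of_forall fun n ↦ norm_eulerTerm_le hM ?_)
    rw [norm_mul, norm_pow]
    exact mul_le_of_le_one_right (norm_nonneg _) (pow_le_one₀ (norm_nonneg _) hq.le)
  have h0 : ∑' k, eulerTerm q 0 k = 1 := by
    rw [tsum_eq_single 0 fun k hk ↦ by simp [eulerTerm, hk]]
    simp [eulerTerm, qPoch]
  have h := (tendsto_qPoch x hq).mul hlim
  simp only [← tsum_eulerTerm_eq_qPoch_mul hq, h0, mul_one] at h
  exact tendsto_nhds_unique tendsto_const_nhds h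

theorem tsum_cauchyTerm_sub {q : ℂ} (hq : ‖q‖ < 1) (k : ℕ) :
    ∑' j, cauchyTerm q k j - ∑' j, cauchyTerm q (k + 1) j
      = -q ^ (k + 1) * (∑' j, cauchyTerm q (k + 1) j - ∑' j, cauchyTerm q (k + 2) j) := by
  have hs := summable_cauchyTerm hq k
  have hs' := (summable_cauchyTerm hq (k + 1)).mul_left (1 - q ^ (k + 1))
  have h0 : cauchyTerm q k 0 - (1 - q ^ (k + 1)) * cauchyTerm q (k + 1) 0 = 0 := by
    have hP := qPoch_self_ne_zero hq k
    have hf := one_sub_pow_succ_ne_zero hq k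
    simp only [cauchyTerm, zero_add, qPoch_self_succ]
    field_simp
    ring
  have h1 (j : ℕ) : cauchyTerm q k (j + 1) - (1 - q ^ (k + 1)) * cauchyTerm q (k + 1) (j + 1)
      = q ^ (k + 1) * cauchyTerm q (k + 2) j := by
    have hP := qPoch_self_ne_zero hq j
    have hR := qPoch_self_ne_zero hq (j + 1 + k)
    have hf := one_sub_pow_succ_ne_zero hq j
    have hf' := one_sub_pow_succ_ne_zero hq (j + 1 + k)
    have e1 : j + 1 + (k + 1) = j + 1 + k + 1 := by ring
    have e2 : j + (k + 2) = j + 1 + k + 1 := by ring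
    simp only [cauchyTerm, e1, e2, qPoch_self_succ q j, qPoch_self_succ q (j + 1 + k)]
    field_simp
    ring
  have h := (hs.sub hs').tsum_eq_zero_add
  rw [hs.tsum_sub hs', h0, zero_add] at h
  simp only [h1, tsum_mul_left] at h
  linear_combination h

theorem tendsto_tsum_cauchyTerm {q : ℂ} (hq : ‖q‖ < 1) :
    Tendsto (fun k ↦ ∑' j, cauchyTerm q k j) atTop (𝓝 (qPochInf q q)⁻¹) := by
  obtain ⟨M, -, hM⟩ := exists_norm_inv_qPoch_self_le hq
  have hlim : Tendsto (fun k ↦ ∑' j, cauchyTerm q k j) atTop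
      (𝓝 (∑' j : ℕ, q ^ j ^ 2 * 0 ^ j * (qPoch q q j)⁻¹ * (qPochInf q q)⁻¹)) := by
    refine tendsto_tsum_of_dominated_convergence
      ((summable_geometric_of_lt_one (norm_nonneg q) hq).mul_left (M * M))
      (fun j ↦ ?_) (.of_forall fun k ↦ norm_cauchyTerm_le hq hM k)
    have hP : Tendsto (fun k ↦ (qPoch q q (j + k))⁻¹) atTop (𝓝 (qPochInf q q)⁻¹) := by
      simpa only [add_comm j] using (tendsto_add_atTop_iff_nat j).mpr (tendsto_inv_qPoch_self hq)
    exact ((((tendsto_pow_atTop_nhds_zero_of_norm_lt_one hq).pow j).const_mul _).mul_const _).mul hP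
  rw [tsum_eq_single 0 fun j hj ↦ by simp [hj]] at hlim
  simpa [qPoch] using hlim

/-- Cauchy's Durfee-rectangle expansion of `1 / (q; q)_∞`. -/
theorem tsum_cauchyTerm {q : ℂ} (hq : ‖q‖ < 1) (k : ℕ) :
    ∑' j, cauchyTerm q k j = (qPochInf q q)⁻¹ := by
  have hlim := tendsto_tsum_cauchyTerm hq
  set G : ℕ → ℂ := fun k ↦ ∑' j, cauchyTerm q k j
  have hstep (n : ℕ) : ‖G n - G (n + 1)‖ ≤ ‖G (n + 1) - G (n + 1 + 1)‖ := by
    have h : G n - G (n + 1) = -q ^ (n + 1) * (G (n + 1) - G (n + 1 + 1)) :=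
      tsum_cauchyTerm_sub hq n
    rw [h, norm_mul, norm_neg, norm_pow]
    exact mul_le_of_le_one_left (norm_nonneg _) (pow_le_one₀ (norm_nonneg _) hq.le)
  have hmono : Monotone fun n ↦ ‖G n - G (n + 1)‖ := monotone_nat_of_le_succ hstep
  have hzero : Tendsto (fun n ↦ ‖G n - G (n + 1)‖) atTop (𝓝 0) := by
    simpa using (hlim.sub ((tendsto_add_atTop_iff_nat 1).mpr hlim)).norm
  have hconst (n : ℕ) : G n = G (n + 1) :=
    sub_eq_zero.mp (norm_le_zero_iff.mp (hmono.ge_of_tendsto hzero n))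
  have hG0 (n : ℕ) : G n = G 0 := by
    induction n with
    | zero => rfl
    | succ n ih => rw [← hconst, ih]
  have hlim0 : Tendsto G atTop (𝓝 (G 0)) := by
    rw [funext hG0]
    exact tendsto_const_nhds
  exact (hG0 k).trans (tendsto_nhds_unique hlim0 hlim)

theorem summable_eulerTerm_mul_cauchyTerm {q : ℂ} (hq : ‖q‖ < 1) (x : ℂ) :
    Summable fun p : ℕ × ℕ ↦ eulerTerm q x p.1 * cauchyTerm q p.1 p.2 := by
  obtain ⟨M, hM0, hM⟩ := exists_norm_inv_qPoch_self_le hq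
  refine .of_norm_bounded
    (((summable_pow_mul_pow_choose_two ‖x‖ (norm_nonneg q) hq).mul_left M).mul_of_nonneg
      ((summable_geometric_of_lt_one (norm_nonneg q) hq).mul_left (M * M))
      (fun k ↦ by positivity) (fun j ↦ by positivity)) fun p ↦ ?_
  rw [norm_mul]
  exact mul_le_mul (norm_eulerTerm_le hM le_rfl _) (norm_cauchyTerm_le hq hM _ _)
    (norm_nonneg _) (by positivity)

theorem choose_two_add_choose_two_add (k j : ℕ) :
    (k + j).choose 2 + j.choose 2 + j = k.choose 2 + (j ^ 2 + k * j) := by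
  induction j with
  | zero => simp
  | succ j ih =>
    rw [← add_assoc k j 1, Nat.choose_succ_succ' (k + j) 1, Nat.choose_succ_succ' j 1,
      Nat.choose_one_right, Nat.choose_one_right]
    linarith

theorem stmt_2 (x q : ℂ) (hq : ‖q‖ < 1) :
    (∑' p : ℕ × ℕ,
        (-1 : ℂ) ^ p.1 * x ^ p.1 *
          q ^ (Nat.choose (p.1 + p.2) 2 + Nat.choose p.2 2 + p.2) /
          (qPoch q q p.1 * qPoch q q p.2 * qPoch q q (p.1 + p.2)))
      = qPochInf x q / qPochInf q q := by
  calc _ = ∑' p : ℕ × ℕ, eulerTerm q x p.1 * cauchyTerm q p.1 p.2 := by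
        refine tsum_congr fun p ↦ ?_
        rw [choose_two_add_choose_two_add, pow_add, pow_add, pow_mul, eulerTerm, cauchyTerm,
          add_comm p.2 p.1, div_eq_mul_inv, mul_inv, mul_inv]
        ring
    _ = ∑' k, eulerTerm q x k * (qPochInf q q)⁻¹ := by
        rw [(summable_eulerTerm_mul_cauchyTerm hq x).tsum_prod]
        simp only [tsum_mul_left, tsum_cauchyTerm hq]
    _ = qPochInf x q / qPochInf q q := by
        rw [tsum_mul_right, tsum_eulerTerm hq, div_eq_mul_inv]
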